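/- Let A be a k-algebra that is a domain and suppose that the divisor subalgebra D_A(1) contains the center Z(A). Then A is strongly cancellative. -/

import Mathlib

open scoped TensorProduct

universe u

/-- The polynomial extension `A[t₁,…,tₙ]` of a (possibly noncommutative) `k`-algebra `A`
in `n` central, mutually commuting indeterminates. -/
abbrev PolyExt (A : Type u) [Ring A] (n : ℕ) : Type u :=
  AddMonoidAlgebra A (Fin n →₀ ℕ)

/-- The canonical embedding `A → A[t₁,…,tₙ]` as constant polynomials. -/
noncomputable def PolyExt.C (k A : Type u) [Field k] [Ring A] [Algebra k A] (n : ℕ) :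
    A →ₐ[k] PolyExt A n :=
  AddMonoidAlgebra.singleZeroAlgHom

/-- The `i`-th indeterminate of `A[t₁,…,tₙ]`. -/
noncomputable def PolyExt.X (A : Type u) [Ring A] (n : ℕ) (i : Fin n) : PolyExt A n :=
  AddMonoidAlgebra.single (Finsupp.single i 1) 1

/-- Two rings are Morita equivalent if their categories of right modules are
equivalent (as abelian categories). -/
def MoritaEquivalent (R S : Type u) [Ring R] [Ring S] : Prop :=
  Nonempty (ModuleCat.{u} Rᵐᵒᵖ ≌ ModuleCat.{u} Sᵐᵒᵖ)

/-- `A` is strongly cancellative: for every `n ≥ 1` and every `k`-algebra `B`, any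
`k`-algebra isomorphism `A[s₁,…,sₙ] ≅ B[t₁,…,tₙ]` implies `A ≅ B`. -/
def StronglyCancellative (k A : Type u) [Field k] [Ring A] [Algebra k A] : Prop :=
  ∀ (n : ℕ), 1 ≤ n → ∀ (B : Type u) [Ring B] [Algebra k B],
    Nonempty (PolyExt A n ≃ₐ[k] PolyExt B n) → Nonempty (A ≃ₐ[k] B)

/-- `A` is strongly Morita cancellative: for every `n ≥ 1` and every `k`-algebra `B`,
Morita equivalence of `A[s₁,…,sₙ]` and `B[t₁,…,tₙ]` implies Morita equivalence of `A` and `B`. -/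
def StronglyMoritaCancellative (k A : Type u) [Field k] [Ring A] [Algebra k A] : Prop :=
  ∀ (n : ℕ), 1 ≤ n → ∀ (B : Type u) [Ring B] [Algebra k B],
    MoritaEquivalent (PolyExt A n) (PolyExt B n) → MoritaEquivalent A B

/-- `A` is strongly retractable: every `k`-algebra isomorphism
`φ : A[s₁,…,sₙ] → B[t₁,…,tₙ]` (with `n ≥ 1`) satisfies `φ(A) = B`. -/
def StronglyRetractable (k A : Type u) [Field k] [Ring A] [Algebra k A] : Prop :=
  ∀ (n : ℕ), 1 ≤ n → ∀ (B : Type u) [Ring B] [Algebra k B]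
    (φ : PolyExt A n ≃ₐ[k] PolyExt B n),
    φ '' Set.range (PolyExt.C k A n) = Set.range (PolyExt.C k B n)

/-- `A` is strongly detectable: for every `k`-algebra isomorphism
`φ : A[s₁,…,sₙ] → B[t₁,…,tₙ]` (with `n ≥ 1`), the subalgebra of `B[t₁,…,tₙ]` generated by
`B` together with `φ(s₁),…,φ(sₙ)` is all of `B[t₁,…,tₙ]`. -/
def StronglyDetectable (k A : Type u) [Field k] [Ring A] [Algebra k A] : Prop :=
  ∀ (n : ℕ), 1 ≤ n → ∀ (B : Type u) [Ring B] [Algebra k B]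
    (φ : PolyExt A n ≃ₐ[k] PolyExt B n),
    Algebra.adjoin k
      (Set.range (PolyExt.C k B n) ∪ Set.range fun i => φ (PolyExt.X A n i)) = ⊤

/-- `Sw(F)`: the set of all `g` such that `f = a * g * b` for some `a, b` and some
nonzero `f ∈ F` (the set of subwords of elements of `F`). -/
def subwords {A : Type u} [Ring A] (F : Set A) : Set A :=
  {g | ∃ f ∈ F, f ≠ 0 ∧ ∃ a b : A, f = a * g * b}

/-- The `n`-th stage `Dₙ(F)` in the construction of the divisor subalgebra:
`D₀(F) = F` and `Dₙ₊₁(F)` is the `k`-subalgebra generated by `Sw(Dₙ(F))`. -/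
def divisorStage (k : Type u) {A : Type u} [Field k] [Ring A] [Algebra k A] :
    ℕ → Set A → Set A
  | 0, F => F
  | n + 1, F => (Algebra.adjoin k (subwords (divisorStage k n F)) : Subalgebra k A)

/-- The divisor subalgebra `𝔻_A(F) = ⋃ₙ Dₙ(F)`. -/
def divisorSubalgebra (k : Type u) {A : Type u} [Field k] [Ring A] [Algebra k A]
    (F : Set A) : Set A :=
  ⋃ n, divisorStage k n F

namespace PolyExt

section
variable {k A B : Type u} [Field k] [Ring A] [Algebra k A] [Ring B] [Algebra k B] {n : ℕ}

theorem C_apply (a : A) : C k A n a = AddMonoidAlgebra.single 0 a := rfl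

theorem C_injective : Function.Injective (C k A n) := fun a b h => by
  simpa [C_apply] using h

/-- Every monomial `t^m` commutes with every element of the polynomial extension. -/
theorem commute_monomial (m : Fin n →₀ ℕ) (p : PolyExt A n) :
    Commute (AddMonoidAlgebra.single m (1 : A)) p :=
  AddMonoidAlgebra.single_commute (fun m' => AddCommute.all m m') (fun r => Commute.one_left r) p

theorem X_mem_center (i : Fin n) : X A n i ∈ Subalgebra.center k (PolyExt A n) :=
  Subalgebra.mem_center_iff.2 fun p => ((commute_monomial _ p).eq).symm

/-- Coefficients of a central polynomial are central. -/
theorem coeff_mem_center {p : PolyExt A n} (hp : p ∈ Subalgebra.center k (PolyExt A n))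
    (m : Fin n →₀ ℕ) : p.coeff m ∈ Subalgebra.center k A := by
  rw [Subalgebra.mem_center_iff] at hp ⊢
  intro a
  have := congrArg (fun q => AddMonoidAlgebra.coeff q m) (hp (AddMonoidAlgebra.single 0 a))
  simpa [AddMonoidAlgebra.coeff_single_zero_mul, AddMonoidAlgebra.coeff_mul_single_zero] using this

theorem C_mem_center {z : A} (hz : z ∈ Subalgebra.center k A) :
    C k A n z ∈ Subalgebra.center k (PolyExt A n) := by
  rw [Subalgebra.mem_center_iff] at hz ⊢
  intro p
  apply AddMonoidAlgebra.coeff_injective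
  ext m
  simp [C_apply, AddMonoidAlgebra.coeff_single_zero_mul, AddMonoidAlgebra.coeff_mul_single_zero, hz]

/-- Two homomorphisms out of a polynomial extension agree once they agree on constants and
indeterminates. -/
theorem hom_ext {f g : PolyExt A n →ₐ[k] B} (hC : ∀ a, f (C k A n a) = g (C k A n a))
    (hX : ∀ i, f (X A n i) = g (X A n i)) : f = g := by
  refine AddMonoidAlgebra.algHom_ext (fun m => ?_) (AlgHom.ext hC)
  induction m using Finsupp.induction_linear with
  | zero => exact (map_one f).trans (map_one g).symm
  | add m m' hm hm' =>
    rw [← mul_one (1 : A), ← AddMonoidAlgebra.single_mul_single, map_mul, map_mul, hm, hm']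
  | single i e =>
    have : AddMonoidAlgebra.single (Finsupp.single i e) (1 : A) = X A n i ^ e := by
      simp [X, AddMonoidAlgebra.single_pow]
    rw [this, map_pow, map_pow, hX]

/-- Evaluation of the indeterminates at central elements. -/
noncomputable def eval (c : Fin n → Subalgebra.center k B) : PolyExt B n →ₐ[k] B :=
  AddMonoidAlgebra.liftNCAlgHom (AlgHom.id k B)
    { toFun := fun m => ((∏ i, c i ^ (m.toAdd i) : Subalgebra.center k B) : B)
      map_one' := by simp
      map_mul' := fun m m' => by simp [pow_add, Finset.prod_mul_distrib] }
    (fun x _ => (Subalgebra.mem_center_iff.1 (SetLike.coe_mem _) x : Commute _ _))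

theorem eval_C (c : Fin n → Subalgebra.center k B) (b : B) : eval c (C k B n b) = b := by
  exact (AddMonoidAlgebra.liftNC_single _ _ _ _).trans (by simp)

theorem eval_X (c : Fin n → Subalgebra.center k B) (i : Fin n) : eval c (X B n i) = c i := by
  classical
  refine (AddMonoidAlgebra.liftNC_single _ _ _ _).trans ?_
  simp [Finsupp.single_apply, Finset.prod_ite_eq, pow_ite]

theorem eval_mem_center (c : Fin n → Subalgebra.center k B) {p : PolyExt B n}
    (hp : p ∈ Subalgebra.center k (PolyExt B n)) : eval c p ∈ Subalgebra.center k B := by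
  rw [Subalgebra.mem_center_iff] at hp ⊢
  intro b
  simpa [eval_C] using congrArg (eval c) (hp (C k B n b))

/-- The centre of a polynomial extension is the polynomial ring over the centre. The description
is transported along an isomorphism of algebras. -/
noncomputable def centerEquiv {Q : Type u} [Ring Q] [Algebra k Q] (φ : PolyExt A n ≃ₐ[k] Q) :
    MvPolynomial (Fin n) (Subalgebra.center k A) ≃+* Subalgebra.center k Q :=
  RingEquiv.ofBijective
    (((φ : PolyExt A n →+* Q).comp (AddMonoidAlgebra.mapRingHom (Fin n →₀ ℕ)
      ((Subalgebra.center k A).val : Subalgebra.center k A →+* A))).codRestrict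
      (Subalgebra.center k Q) fun p => by
        rw [Subalgebra.mem_center_iff]
        intro q
        obtain ⟨q, rfl⟩ := φ.surjective q
        refine (map_mul φ _ _).symm.trans (Eq.trans (congrArg φ ?_) (map_mul φ _ _))
        induction p using MvPolynomial.induction_on' with
        | monomial m z =>
          simp only [MvPolynomial.monomial, AddMonoidAlgebra.lsingle_apply,
            AddMonoidAlgebra.mapRingHom_single]
          exact (AddMonoidAlgebra.single_commute (fun m' => AddCommute.all m m')
            (fun r => (Subalgebra.mem_center_iff.1 z.2 r).symm) q).symm
        | add p p' hp hp' => rw [map_add, mul_add, add_mul, hp, hp'])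
    (by
      constructor
      · intro p p' h
        have h := φ.injective (congrArg Subtype.val h)
        apply AddMonoidAlgebra.coeff_injective
        ext m
        simpa using congrArg (fun q => AddMonoidAlgebra.coeff q m) h
      · rintro ⟨q, hq⟩
        obtain ⟨q, rfl⟩ := φ.surjective q
        have hq : q ∈ Subalgebra.center k (PolyExt A n) := by
          rw [Subalgebra.mem_center_iff] at hq ⊢
          exact fun p => φ.injective (by simpa using hq (φ p))
        refine ⟨.ofCoeff (Finsupp.onFinset q.coeff.support
          (fun m => ⟨q.coeff m, coeff_mem_center hq m⟩) fun m hm => ?_), Subtype.ext ?_⟩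
        · exact Finsupp.mem_support_iff.2 fun h0 => hm (Subtype.ext h0)
        · refine congrArg φ (AddMonoidAlgebra.coeff_injective (Finsupp.ext fun m => ?_))
          simp)

theorem coe_centerEquiv_C {Q : Type u} [Ring Q] [Algebra k Q] (φ : PolyExt A n ≃ₐ[k] Q)
    (z : Subalgebra.center k A) :
    (centerEquiv φ (MvPolynomial.C z) : Q) = φ (C k A n z) :=
  congrArg φ (AddMonoidAlgebra.mapRingHom_single _ _ _)

theorem coe_centerEquiv_X {Q : Type u} [Ring Q] [Algebra k Q] (φ : PolyExt A n ≃ₐ[k] Q)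
    (i : Fin n) :
    (centerEquiv φ (MvPolynomial.X i) : Q) = φ (X A n i) :=
  congrArg φ (AddMonoidAlgebra.mapRingHom_single _ _ _)

/-- Homomorphisms agree on the centre of a polynomial extension once they agree on central
constants and indeterminates. -/
theorem hom_eq_on_center {f g : PolyExt A n →ₐ[k] B}
    (hC : ∀ z ∈ Subalgebra.center k A, f (C k A n z) = g (C k A n z))
    (hX : ∀ i, f (X A n i) = g (X A n i)) {p : PolyExt A n}
    (hp : p ∈ Subalgebra.center k (PolyExt A n)) : f p = g p := by
  let ι : MvPolynomial (Fin n) (Subalgebra.center k A) →+* PolyExt A n :=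
    ((Subalgebra.center k (PolyExt A n)).val : _ →+* PolyExt A n).comp
      (centerEquiv (AlgEquiv.refl : PolyExt A n ≃ₐ[k] PolyExt A n)).toRingHom
  have h : (f : PolyExt A n →+* B).comp ι = (g : PolyExt A n →+* B).comp ι := by
    refine MvPolynomial.ringHom_ext (fun z => ?_) (fun i => ?_)
    · simpa [ι, coe_centerEquiv_C] using hC z z.2
    · simpa [ι, coe_centerEquiv_X] using hX i
  obtain ⟨q, hq⟩ :=
    (centerEquiv (AlgEquiv.refl : PolyExt A n ≃ₐ[k] PolyExt A n)).surjective ⟨p, hp⟩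
  have := congrArg (fun r => r q) h
  simpa [ι, hq] using this

end

section
variable {k B : Type u} [Field k] [Ring B] [Algebra k B] {n : ℕ}

theorem eq_C_of_supDegree_eq_zero {g : PolyExt B n}
    (h : g.supDegree (toLex : (Fin n →₀ ℕ) → Lex (Fin n →₀ ℕ)) = 0) :
    g = C k B n (g.coeff 0) := by
  apply AddMonoidAlgebra.coeff_injective
  ext m
  rw [C_apply, AddMonoidAlgebra.coeff_single, Finsupp.single_apply]
  split_ifs with hm
  · rw [hm]
  · refine AddMonoidAlgebra.coeff_eq_zero_of_not_le_supDegree (D := toLex) ?_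
    rw [h]
    intro hle
    exact hm (toLex.injective (le_bot_iff.1 hle)).symm

theorem supDegree_mul [IsDomain B] {p q : PolyExt B n} (hp : p ≠ 0) (hq : q ≠ 0) :
    (p * q).supDegree (toLex : (Fin n →₀ ℕ) → Lex (Fin n →₀ ℕ)) =
      p.supDegree toLex + q.supDegree toLex := by
  refine AddMonoidAlgebra.supDegree_mul toLex.injective (fun _ _ => rfl) ?_ hp hq
  refine mul_ne_zero ?_ ?_ <;> rwa [Ne, AddMonoidAlgebra.leadingCoeff_eq_zero toLex.injective]

/-- Over a domain, divisors of nonzero constants are constants. -/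
theorem mem_range_C_of_mul_mul_eq [IsDomain B] {a g b : PolyExt B n} {c : B} (hc : c ≠ 0)
    (h : C k B n c = a * g * b) : g ∈ (C k B n).range := by
  have hne : a * g * b ≠ 0 := by
    rw [← h]
    exact fun h0 => hc (C_injective (h0.trans (map_zero _).symm))
  have hag := left_ne_zero_of_mul hne
  have hdeg : (a * g * b).supDegree (toLex : (Fin n →₀ ℕ) → Lex (Fin n →₀ ℕ)) = 0 := by
    rw [← h, C_apply, AddMonoidAlgebra.supDegree_single_ne_zero _ hc]
    rfl
  rw [supDegree_mul hag (right_ne_zero_of_mul hne),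
    supDegree_mul (left_ne_zero_of_mul hag) (right_ne_zero_of_mul hag)] at hdeg
  have hg : g.supDegree (toLex : (Fin n →₀ ℕ) → Lex (Fin n →₀ ℕ)) = 0 := by
    have hnn (x : Lex (Fin n →₀ ℕ)) : 0 ≤ x := bot_le
    have h1 := ((add_eq_zero_iff_of_nonneg (hnn _) (hnn _)).1 hdeg).1
    exact ((add_eq_zero_iff_of_nonneg (hnn _) (hnn _)).1 h1).2
  exact ⟨_, (eq_C_of_supDegree_eq_zero hg).symm⟩

/-- The divisor subalgebra generated by `1` consists of constants. -/
theorem divisorStage_subset_range_C [IsDomain B] (m : ℕ) :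
    divisorStage k m ({1} : Set (PolyExt B n)) ⊆ (C k B n).range := by
  induction m with
  | zero => exact Set.singleton_subset_iff.2 (one_mem _)
  | succ m ih =>
    refine SetLike.coe_subset_coe.2 (Algebra.adjoin_le ?_)
    rintro g ⟨f, hf, hf0, a, b, hfab⟩
    obtain ⟨c, rfl⟩ := ih hf
    exact mem_range_C_of_mul_mul_eq (k := k) (fun hc => hf0 (by rw [hc]; exact map_zero _)) hfab

end

end PolyExt

/-- Injective homomorphisms map each stage of the divisor subalgebra of `1` into the
corresponding stage. -/
theorem map_mem_divisorStage {k A B : Type u} [Field k] [Ring A] [Algebra k A] [Ring B]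
    [Algebra k B] (f : A →ₐ[k] B) (hf : Function.Injective f) (m : ℕ) :
    ∀ x ∈ divisorStage k m ({1} : Set A), f x ∈ divisorStage k m ({1} : Set B) := by
  induction m with
  | zero =>
    rintro x rfl
    exact map_one f
  | succ m ih =>
    suffices Algebra.adjoin k (subwords (divisorStage k m ({1} : Set A))) ≤
        (Algebra.adjoin k (subwords (divisorStage k m ({1} : Set B)))).comap f from
      fun x hx => this hx
    refine Algebra.adjoin_le ?_
    rintro g ⟨c, hc, hc0, a, b, rfl⟩
    refine Algebra.subset_adjoin ⟨_, ih _ hc, (map_ne_zero_iff f hf).2 hc0, f a, f b, ?_⟩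
    simp

/-- An element of a polynomial ring over a domain that is algebraic over the coefficients is
constant. -/
theorem MvPolynomial.exists_C_eq_of_isAlgebraic {R : Type u} [CommRing R] [IsDomain R] {n : ℕ}
    {p : MvPolynomial (Fin n) R} (hp : IsAlgebraic R p) : ∃ r, C r = p := by
  rcases eq_or_ne p 0 with rfl | hp0
  · exact ⟨0, map_zero _⟩
  obtain ⟨r, hr0, q, hq⟩ := hp.exists_nonzero_dvd (mem_nonZeroDivisors_of_ne_zero hp0)
  have := MvPolynomial.totalDegree_mul_of_isDomain hp0 (right_ne_zero_of_mul (a := p) (b := q) ?_)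
  · rw [← hq, algebraMap_eq, totalDegree_C] at this
    exact ⟨_, ((totalDegree_eq_zero_iff_eq_C).1 (by omega)).symm⟩
  · rw [← hq, algebraMap_eq]
    exact C_ne_zero.2 hr0

/-- If `R → S` extends to an isomorphism of polynomial rings in the same finite number of
variables over domains, then it is surjective. -/
theorem MvPolynomial.surjective_of_ringEquiv {R S : Type u} [CommRing R] [IsDomain R]
    [CommRing S] [IsDomain S] {n : ℕ} (f : R →+* S)
    (Φ : MvPolynomial (Fin n) R ≃+* MvPolynomial (Fin n) S) (hΦ : ∀ r, Φ (C r) = C (f r)) :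
    Function.Surjective f := by
  let := f.toAlgebra
  have hf : Function.Injective (algebraMap R S) := fun x y hxy =>
    C_injective _ _ (Φ.injective (by rw [hΦ, hΦ]; exact congrArg C hxy))
  have : FaithfulSMul R S := (faithfulSMul_iff_algebraMap_injective R S).2 hf
  let e : MvPolynomial (Fin n) R ≃ₐ[R] MvPolynomial (Fin n) S :=
    AlgEquiv.ofRingEquiv (f := Φ) hΦ
  have h1 := e.trdeg_eq
  have h2 := trdeg_add_eq R S (A := MvPolynomial (Fin n) S)
  rw [← h1, trdeg_of_isDomain, trdeg_of_isDomain] at h2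
  have h3 : Algebra.trdeg R S = 0 :=
    Cardinal.eq_of_add_eq_add_right (h2.trans (zero_add _).symm) (by simp)
  have h4 : Algebra.IsAlgebraic R S := trdeg_eq_zero_iff.1 h3
  intro s
  have hs : IsAlgebraic R (C s : MvPolynomial (Fin n) S) :=
    (h4.isAlgebraic s).algebraMap
  obtain ⟨r, hr⟩ := exists_C_eq_of_isAlgebraic
    ((isAlgebraic_algHom_iff e.symm.toAlgHom e.symm.injective).2 hs)
  refine ⟨r, C_injective (Fin n) S ?_⟩
  rw [← hΦ, hr]
  exact e.apply_symm_apply _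

namespace PolyExt

/-- An isomorphism of polynomial extensions of domains that maps central constants to constants
maps the centre onto the centre. -/
theorem exists_center_eq {k A B : Type u} [Field k] [Ring A] [Algebra k A] [IsDomain A] [Ring B]
    [Algebra k B] [IsDomain B] {n : ℕ} (φ : PolyExt A n ≃ₐ[k] PolyExt B n)
    (h : ∀ z ∈ Subalgebra.center k A, ∃ w ∈ Subalgebra.center k B, φ (C k A n z) = C k B n w) :
    ∀ w ∈ Subalgebra.center k B, ∃ z ∈ Subalgebra.center k A, φ (C k A n z) = C k B n w := by
  let eB := centerEquiv (AlgEquiv.refl : PolyExt B n ≃ₐ[k] PolyExt B n)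
  have hBC (z : Subalgebra.center k B) : (eB (MvPolynomial.C z) : PolyExt B n) = C k B n z :=
    coe_centerEquiv_C _ z
  choose f hf hfφ using h
  have hinj : Function.Injective (C k B n) := C_injective
  let F : Subalgebra.center k A →+* Subalgebra.center k B :=
    { toFun := fun z => ⟨f z z.2, hf z z.2⟩
      map_one' := Subtype.ext (hinj (by simp [← hfφ]))
      map_zero' := Subtype.ext (hinj (by simp [← hfφ]))
      map_mul' := fun x y => Subtype.ext (hinj (by simp [← hfφ]))
      map_add' := fun x y => Subtype.ext (hinj (by simp [← hfφ])) }
  have hsurj := MvPolynomial.surjective_of_ringEquiv F ((centerEquiv φ).trans eB.symm) fun z => by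
    refine eB.injective (Subtype.ext ?_)
    rw [RingEquiv.trans_apply, RingEquiv.apply_symm_apply, coe_centerEquiv_C, hBC]
    exact hfφ z z.2
  intro w hw
  obtain ⟨z, hz⟩ := hsurj ⟨w, hw⟩
  refine ⟨z, z.2, (hfφ z z.2).trans ?_⟩
  exact congrArg (C k B n) (congrArg Subtype.val hz)

/-- If an isomorphism of polynomial extensions identifies the centres of the coefficient
algebras, then the coefficient algebras are isomorphic. -/
theorem nonempty_algEquiv {k A B : Type u} [Field k] [Ring A] [Algebra k A] [Ring B]
    [Algebra k B] {n : ℕ} (φ : PolyExt A n ≃ₐ[k] PolyExt B n)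
    (hAB : ∀ z ∈ Subalgebra.center k A, ∃ w ∈ Subalgebra.center k B, φ (C k A n z) = C k B n w)
    (hBA : ∀ w ∈ Subalgebra.center k B, ∃ z ∈ Subalgebra.center k A, φ (C k A n z) = C k B n w) :
    Nonempty (A ≃ₐ[k] B) := by
  let ε : PolyExt A n →ₐ[k] A := eval 0
  have hεX (i : Fin n) : ε (X A n i) = 0 := eval_X 0 i
  have hεC (a : A) : ε (C k A n a) = a := eval_C 0 a
  have hmap {p : PolyExt A n} (hp : p ∈ Subalgebra.center k (PolyExt A n)) :
      φ p ∈ Subalgebra.center k (PolyExt B n) := by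
    rw [Subalgebra.mem_center_iff] at hp ⊢
    exact fun q => φ.symm.injective (by simpa using hp (φ.symm q))
  have hsymm {p : PolyExt B n} (hp : p ∈ Subalgebra.center k (PolyExt B n)) :
      φ.symm p ∈ Subalgebra.center k (PolyExt A n) := by
    rw [Subalgebra.mem_center_iff] at hp ⊢
    exact fun q => φ.injective (by simpa using hp (φ q))
  have hc (i : Fin n) : ∃ w ∈ Subalgebra.center k B,
      φ (C k A n (ε (φ.symm (X B n i)))) = C k B n w :=
    hAB _ (eval_mem_center 0 (hsymm (X_mem_center i)))
  choose c hcZ hcφ using hc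
  let τ : PolyExt B n →ₐ[k] B := eval fun i => ⟨c i, hcZ i⟩
  have hτX (i : Fin n) : τ (X B n i) = c i := eval_X _ i
  have hτC (b : B) : τ (C k B n b) = b := eval_C _ b
  let α : A →ₐ[k] B := (τ.comp φ.toAlgHom).comp (C k A n)
  let β : B →ₐ[k] A := (ε.comp φ.symm.toAlgHom).comp (C k B n)
  have hα (a : A) : α a = τ (φ (C k A n a)) := rfl
  have hβ (b : B) : β b = ε (φ.symm (C k B n b)) := rfl
  have hτφX (j : Fin n) : τ (φ (X A n j)) = 0 := by
    have key := hom_eq_on_center (f := (C k B n).comp τ)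
      (g := φ.toAlgHom.comp ((C k A n).comp (ε.comp φ.symm.toAlgHom))) (fun w hw => ?_)
      (fun i => ?_) (hmap (X_mem_center (A := A) j))
    · refine C_injective (k := k) (n := n) ?_
      simpa [hεX] using key
    · obtain ⟨z, -, hz⟩ := hBA w hw
      have hw' : φ.symm (C k B n w) = C k A n z := by rw [← hz, AlgEquiv.symm_apply_apply]
      simp [hτC, hw', hεC, hz]
    · simp [hτX, hcφ]
  have hατ : α.comp ε = τ.comp φ.toAlgHom :=
    hom_ext (fun a => by simp [hεC, hα]) (fun i => by simp [hεX, hτφX])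
  have hβε : β.comp τ = ε.comp φ.symm.toAlgHom :=
    hom_ext (fun b => by simp [hτC, hβ]) (fun i => by simp [hτX, hβ, ← hcφ, hεC])
  refine ⟨AlgEquiv.ofAlgHom α β (AlgHom.ext fun b => ?_) (AlgHom.ext fun a => ?_)⟩
  · have := DFunLike.congr_fun hατ (φ.symm (C k B n b))
    simpa [hβ, hτC] using this
  · have := DFunLike.congr_fun hβε (φ (C k A n a))
    simpa [hα, hεC] using this

end PolyExt

/-- If `A` is a domain whose divisor subalgebra `𝔻_A(1)` contains
the center `Z(A)`, then `A` is strongly cancellative. -/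
theorem strongly_cancellative_of_divisor_subalgebra_contains_center
    (k A : Type u) [Field k] [Ring A] [Algebra k A] [IsDomain A]
    (h : (Subalgebra.center k A : Set A) ⊆ divisorSubalgebra k ({1} : Set A)) :
    StronglyCancellative k A := by
  rintro n - B _ _ ⟨φ⟩
  have hφC : Function.Injective (φ.toAlgHom.comp (PolyExt.C k A n)) :=
    φ.injective.comp (PolyExt.C_injective (k := k))
  have hφCB : Function.Injective (φ.symm.toAlgHom.comp (PolyExt.C k B n)) :=
    φ.symm.injective.comp (PolyExt.C_injective (k := k))
  have : IsDomain B := hφCB.isDomain (φ.symm.toAlgHom.comp (PolyExt.C k B n)).toRingHom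
  have hAB : ∀ z ∈ Subalgebra.center k A, ∃ w ∈ Subalgebra.center k B,
      φ (PolyExt.C k A n z) = PolyExt.C k B n w := by
    intro z hz
    obtain ⟨m, hm⟩ := Set.mem_iUnion.1 (h hz)
    obtain ⟨w, hw : PolyExt.C k B n w = φ (PolyExt.C k A n z)⟩ :=
      PolyExt.divisorStage_subset_range_C m (map_mem_divisorStage _ hφC m z hm)
    refine ⟨w, Subalgebra.mem_center_iff.2 fun b => ?_, hw.symm⟩
    refine PolyExt.C_injective (k := k) (n := n) ?_
    obtain ⟨p, hp⟩ := φ.surjective (PolyExt.C k B n b)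
    have hcomm := congrArg φ (Subalgebra.mem_center_iff.1 (PolyExt.C_mem_center hz) p)
    rw [map_mul, map_mul, hp] at hcomm
    rwa [map_mul, map_mul, hw]
  exact PolyExt.nonempty_algEquiv φ hAB (PolyExt.exists_center_eq φ hAB)
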